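/- Let f be any nonzero element of the ℂ-span of f_1, …, f_r, let q(z) := ∏_{i=1}^n (z − λ_i), let W(x) := det Wr(φ_1, …, φ_N)(x) (a polynomial in x which is not identically zero), and define ψ(x,z) := det Wr(φ_1, …, φ_N, f(·+z))(x) / (W(x)·q(z)) for x, z ∈ ℂ with W(x) ≠ 0 and q(z) ≠ 0, where f(·+z) denotes the function x ↦ f(x+z). Then: (a) for every nonconstant polynomial p ∈ ℂ[z] with p′(λ_i) = 0 for i = 1, …, n there exist an integer m ≥ 1 and rational functions b_0, …, b_m ∈ ℂ(x) with b_m ≠ 0 such that Σ_{k=0}^m b_k(x)·∂_x^k ψ(x,z) = p(z)·ψ(x,z) wherever both sides are defined; and (b) there exist a nonconstant polynomial s ∈ ℂ[x], an integer d ≥ 1 and rational functions c_0, …, c_d ∈ ℂ(z) with c_d ≠ 0 such that Σ_{k=0}^d c_k(z)·∂_z^k ψ(x,z) = s(x)·ψ(x,z) wherever both sides are defined. In particular ψ is a common eigenfunction of nonconstant ordinary differential operators in x and in z, with polynomial eigenvalues depending only on the opposite variable. -/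

import Mathlib

open scoped BigOperators

/-- The generalized Airy operator `L₀ u = u^(r) - ∑_{k=1}^{r-2} a_k u^(k) - x·u`. -/
noncomputable def airyOp (r : ℕ) (a : ℕ → ℂ) (u : ℂ → ℂ) : ℂ → ℂ :=
  fun x => iteratedDeriv r u x
    - (∑ k ∈ Finset.Ico 1 (r - 1), a k * iteratedDeriv k u x) - x * u x

/-- The Wronskian determinant of an `m`-tuple of functions. -/
noncomputable def wrDet (m : ℕ) (g : Fin m → ℂ → ℂ) (x : ℂ) : ℂ :=
  Matrix.det (Matrix.of fun k s : Fin m => iteratedDeriv k.val (g s) x)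

/-- The bordered Wronskian determinant `det Wr(g₁, …, g_m, u)`. -/
noncomputable def wrDetB (m : ℕ) (g : Fin m → ℂ → ℂ) (u : ℂ → ℂ) (x : ℂ) : ℂ :=
  wrDet (m + 1) (Fin.snoc g u) x

/-- The family `φ_{i,j}(x) = γ_i·f_j(x+λ_i) + f_j'(x+λ_i)`, listed in a fixed order
as `φ_1, …, φ_N` with `N = r·n` (index `k` corresponds to `i = k / r`, `j = k % r`). -/
noncomputable def phiFam (r n : ℕ) (f : ℕ → ℂ → ℂ) (lam gam : ℕ → ℂ) :
    Fin (r * n) → ℂ → ℂ :=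
  fun k x => gam (k.val / r) * f (k.val % r) (x + lam (k.val / r)) +
    deriv (f (k.val % r)) (x + lam (k.val / r))

/-- The Vandermonde-type product `V = ∏_{i<j} (λ_i - λ_j)`. -/
noncomputable def vand (n : ℕ) (lam : ℕ → ℂ) : ℂ :=
  ∏ i ∈ Finset.range n, ∏ j ∈ Finset.Ico (i + 1) n, (lam i - lam j)

noncomputable def psiFun (r n : ℕ) (f : ℕ → ℂ → ℂ) (lam gam : ℕ → ℂ)
    (fb : ℂ → ℂ) (x z : ℂ) : ℂ :=
  wrDetB (r * n) (phiFam r n f lam gam) (fun t => fb (t + z)) x /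
    (wrDet (r * n) (phiFam r n f lam gam) x * ∏ i ∈ Finset.range n, (z - lam i))

section Weyl

open Polynomial

variable {𝒜 : Type*} [Ring 𝒜] [Algebra ℂ 𝒜]

/-- `MemWeyl t D Y`: the element `Y` belongs to the subalgebra generated by `t` and `D`. -/
inductive MemWeyl (t D : 𝒜) : 𝒜 → Prop
  | pos : MemWeyl t D t
  | der : MemWeyl t D D
  | scalar (c : ℂ) : MemWeyl t D (algebraMap ℂ 𝒜 c)
  | add {y z : 𝒜} : MemWeyl t D y → MemWeyl t D z → MemWeyl t D (y + z)
  | mul {y z : 𝒜} : MemWeyl t D y → MemWeyl t D z → MemWeyl t D (y * z)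

theorem MemWeyl.one (t D : 𝒜) : MemWeyl t D 1 := by
  simpa using MemWeyl.scalar (t := t) (D := D) 1

theorem MemWeyl.smul {t D y : 𝒜} (c : ℂ) (hy : MemWeyl t D y) : MemWeyl t D (c • y) := by
  rw [Algebra.smul_def]
  exact (MemWeyl.scalar c).mul hy

theorem MemWeyl.sub {t D y z : 𝒜} (hy : MemWeyl t D y) (hz : MemWeyl t D z) :
    MemWeyl t D (y - z) := by
  have : y - z = y + (-1 : ℂ) • z := by rw [neg_one_smul, sub_eq_add_neg]
  rw [this]
  exact hy.add (hz.smul _)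

theorem MemWeyl.aeval {t D y : 𝒜} (hy : MemWeyl t D y) (s : ℂ[X]) : MemWeyl t D (aeval y s) := by
  induction s using Polynomial.induction_on with
  | C c => simpa using MemWeyl.scalar c
  | add p q hp hq => simpa using hp.add hq
  | monomial n c ih =>
    rw [pow_succ, ← mul_assoc, map_mul, aeval_X]
    exact ih.mul hy

theorem MemWeyl.pow {t D y : 𝒜} (hy : MemWeyl t D y) (k : ℕ) : MemWeyl t D (y ^ k) := by
  simpa using hy.aeval (X ^ k)

theorem MemWeyl.sum {t D : 𝒜} {s : Finset ℕ} {y : ℕ → 𝒜} (hy : ∀ k, MemWeyl t D (y k)) :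
    MemWeyl t D (∑ k ∈ s, y k) := by
  induction s using Finset.induction_on with
  | empty => simpa using MemWeyl.scalar (t := t) (D := D) 0
  | insert k s hk ih =>
    rw [Finset.sum_insert hk]
    exact (hy k).add ih

/-- The normally ordered element `∑ₖ dₖ(t) Dᵏ` attached to `d ∈ ℂ[t][D]`. -/
noncomputable def normalForm (t D : 𝒜) (d : ℂ[X][X]) : 𝒜 :=
  eval₂ (aeval t : ℂ[X] →ₐ[ℂ] 𝒜).toRingHom D d

theorem normalForm_add (t D : 𝒜) (d e : ℂ[X][X]) :
    normalForm t D (d + e) = normalForm t D d + normalForm t D e := by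
  simp [normalForm, eval₂_add]

theorem normalForm_monomial (t D : 𝒜) (k : ℕ) (c : ℂ[X]) :
    normalForm t D (monomial k c) = aeval t c * D ^ k := by
  simp [normalForm]

theorem normalForm_C_mul (t D : 𝒜) (c : ℂ[X]) (d : ℂ[X][X]) :
    normalForm t D (C c * d) = aeval t c * normalForm t D d := by
  induction d using Polynomial.induction_on' with
  | add p q hp hq => simp [mul_add, normalForm_add, hp, hq]
  | monomial k a => simp [C_mul_monomial, normalForm_monomial, mul_assoc]

theorem normalForm_eq_sum (t D : 𝒜) (d : ℂ[X][X]) {m : ℕ} (hm : d.natDegree ≤ m) :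
    normalForm t D d = ∑ k ∈ Finset.range (m + 1), aeval t (d.coeff k) * D ^ k := by
  rw [normalForm, eval₂_eq_sum, Polynomial.sum_over_range' _ (by simp) (m + 1) (by omega)]
  rfl

/-- Coefficientwise derivative of a polynomial with polynomial coefficients. -/
noncomputable def coeffDeriv : Module.End ℂ ℂ[X][X] :=
  Polynomial.lsum fun k => ((monomial k : ℂ[X] →ₗ[ℂ[X]] ℂ[X][X]).restrictScalars ℂ) ∘ₗ
    (derivative : ℂ[X] →ₗ[ℂ] ℂ[X])

@[simp]
theorem coeffDeriv_monomial (k : ℕ) (c : ℂ[X]) :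
    coeffDeriv (monomial k c) = monomial k (derivative c) := by
  simp [coeffDeriv, Polynomial.lsum, sum_monomial_index]

theorem coeff_coeffDeriv (m : ℂ[X][X]) (k : ℕ) :
    (coeffDeriv m).coeff k = derivative (m.coeff k) := by
  induction m using Polynomial.induction_on' with
  | add p q hp hq => simp [hp, hq]
  | monomial l a =>
    rw [coeffDeriv_monomial, coeff_monomial, coeff_monomial]
    split_ifs <;> simp

theorem commute_aeval_of_commutator {t D : 𝒜} (h : D * t - t * D = 1) (s : ℂ[X]) :
    D * aeval t s = aeval t s * D + aeval t (derivative s) := by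
  have h' : D * t = t * D + 1 := by rw [← h]; abel
  induction s using Polynomial.induction_on with
  | C a => simp [Algebra.commutes]
  | add p q hp hq => simp only [map_add, mul_add, add_mul, hp, hq]; abel
  | monomial n a ih =>
    have e : (C a * X ^ (n + 1) : ℂ[X]) = C a * X ^ n * X := by ring
    rw [e]
    generalize C a * X ^ n = p at ih
    rw [map_mul, ← mul_assoc, ih, derivative_mul, map_add, map_mul, map_mul, aeval_X, derivative_X,
      map_one, add_mul, mul_assoc, h', mul_add, mul_one, mul_assoc]
    abel

theorem mul_normalForm {t D : 𝒜} (h : D * t - t * D = 1) (d : ℂ[X][X]) :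
    D * normalForm t D d = normalForm t D (coeffDeriv d + X * d) := by
  induction d using Polynomial.induction_on' with
  | add p q hp hq =>
    rw [normalForm_add, mul_add, hp, hq, ← normalForm_add]
    congr 1
    simp only [map_add]
    ring
  | monomial k a =>
    rw [normalForm_add, coeffDeriv_monomial, X_mul_monomial]
    simp only [normalForm_monomial]
    rw [← mul_assoc, commute_aeval_of_commutator h, add_mul, pow_succ', mul_assoc, add_comm]

theorem exists_normalForm {t D : 𝒜} (h : D * t - t * D = 1) {Y : 𝒜} (hY : MemWeyl t D Y) :
    ∃ d, normalForm t D d = Y := by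
  suffices H : ∀ e, ∃ d, normalForm t D d = Y * normalForm t D e by
    obtain ⟨d, hd⟩ := H 1
    exact ⟨d, by rw [hd]; simp [normalForm]⟩
  induction hY with
  | pos => exact fun e => ⟨C X * e, by simp [normalForm_C_mul]⟩
  | der => exact fun e => ⟨_, (mul_normalForm h e).symm⟩
  | scalar c => exact fun e => ⟨C (C c) * e, by simp [normalForm_C_mul]⟩
  | add _ _ hy hz =>
    intro e
    obtain ⟨d₁, h₁⟩ := hy e
    obtain ⟨d₂, h₂⟩ := hz e
    exact ⟨d₁ + d₂, by rw [normalForm_add, h₁, h₂, add_mul]⟩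
  | mul _ _ hy hz =>
    intro e
    obtain ⟨d₁, h₁⟩ := hz e
    obtain ⟨d₂, h₂⟩ := hy d₁
    exact ⟨d₂, by rw [h₂, h₁, mul_assoc]⟩

theorem memWeyl_normalForm (t D : 𝒜) (d : ℂ[X][X]) : MemWeyl t D (normalForm t D d) := by
  rw [normalForm_eq_sum t D d le_rfl]
  exact MemWeyl.sum fun k => (MemWeyl.pos.aeval _).mul (MemWeyl.der.pow _)

/-- Left Ore condition for the powers of `s(t)`. -/
theorem exists_pow_mul_eq_mul_pow {t D : 𝒜} (h : D * t - t * D = 1) (s : ℂ[X]) {Y : 𝒜}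
    (hY : MemWeyl t D Y) (e : ℕ) :
    ∃ E : ℕ, ∃ Z, MemWeyl t D Z ∧ aeval t (s ^ E) * Y = Z * aeval t (s ^ e) := by
  induction hY generalizing e with
  | pos =>
    exact ⟨e, t, .pos, (Polynomial.aeval_X (R := ℂ) t ▸ (Commute.all (s ^ e) X).map (aeval t)).eq⟩
  | der =>
    refine ⟨e + 1, aeval t s * D - aeval t (e • derivative s),
      (MemWeyl.pos.aeval s |>.mul .der).sub (MemWeyl.pos.aeval _), ?_⟩
    have key := commute_aeval_of_commutator h (s ^ e)
    rw [sub_mul, mul_assoc, key, mul_add, ← mul_assoc, ← map_mul, ← pow_succ', ← map_mul, ← map_mul,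
      add_sub_assoc, ← map_sub]
    have : s * derivative (s ^ e) - e • derivative s * s ^ e = 0 := by
      rcases e with _ | e
      · simp
      · rw [derivative_pow_succ]; simp; ring
    rw [this]; simp
  | scalar c => exact ⟨e, algebraMap ℂ 𝒜 c, .scalar c, (Algebra.commutes c _).symm⟩
  | add _ _ hy hz =>
    obtain ⟨E₁, Z₁, hZ₁, h₁⟩ := hy e
    obtain ⟨E₂, Z₂, hZ₂, h₂⟩ := hz e
    refine ⟨E₁ + E₂, aeval t (s ^ E₂) * Z₁ + aeval t (s ^ E₁) * Z₂,
      (MemWeyl.pos.aeval _ |>.mul hZ₁).add (MemWeyl.pos.aeval _ |>.mul hZ₂), ?_⟩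
    rw [mul_add, add_mul, mul_assoc, mul_assoc, ← h₁, ← h₂, ← mul_assoc, ← mul_assoc, ← map_mul,
      ← map_mul, ← pow_add, ← pow_add, add_comm E₂]
  | mul _ _ hy hz =>
    obtain ⟨E₁, Z₁, hZ₁, h₁⟩ := hz e
    obtain ⟨E₂, Z₂, hZ₂, h₂⟩ := hy E₁
    exact ⟨E₂, Z₂ * Z₁, hZ₂.mul hZ₁, by rw [← mul_assoc, h₂, mul_assoc, h₁, mul_assoc]⟩

/-- Right Ore condition for the powers of `s(t)`. -/
theorem exists_mul_pow_eq_pow_mul {t D : 𝒜} (h : D * t - t * D = 1) (s : ℂ[X]) {Y : 𝒜}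
    (hY : MemWeyl t D Y) (e : ℕ) :
    ∃ E : ℕ, ∃ Z, MemWeyl t D Z ∧ Y * aeval t (s ^ E) = aeval t (s ^ e) * Z := by
  induction hY generalizing e with
  | pos =>
    exact ⟨e, t, .pos, (Polynomial.aeval_X (R := ℂ) t ▸ (Commute.all X (s ^ e)).map (aeval t)).eq⟩
  | der =>
    refine ⟨e + 1, aeval t s * D + aeval t ((e + 1) • derivative s),
      (MemWeyl.pos.aeval s |>.mul .der).add (MemWeyl.pos.aeval _), ?_⟩
    have key := commute_aeval_of_commutator h (s ^ (e + 1))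
    rw [key, mul_add, ← mul_assoc, ← map_mul, ← pow_succ, ← map_mul, derivative_pow_succ]
    congr 2
    simp; ring
  | scalar c => exact ⟨e, algebraMap ℂ 𝒜 c, .scalar c, Algebra.commutes c _⟩
  | add _ _ hy hz =>
    obtain ⟨E₁, Z₁, hZ₁, h₁⟩ := hy e
    obtain ⟨E₂, Z₂, hZ₂, h₂⟩ := hz e
    refine ⟨E₁ + E₂, Z₁ * aeval t (s ^ E₂) + Z₂ * aeval t (s ^ E₁),
      (hZ₁.mul (MemWeyl.pos.aeval _)).add (hZ₂.mul (MemWeyl.pos.aeval _)), ?_⟩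
    rw [mul_add, add_mul, ← mul_assoc, ← mul_assoc, ← h₁, ← h₂, mul_assoc, mul_assoc, ← map_mul,
      ← map_mul, ← pow_add, ← pow_add, add_comm E₂]
  | mul _ _ hy hz =>
    obtain ⟨E₁, Z₁, hZ₁, h₁⟩ := hy e
    obtain ⟨E₂, Z₂, hZ₂, h₂⟩ := hz E₁
    exact ⟨E₂, Z₁ * Z₂, hZ₁.mul hZ₂, by rw [mul_assoc, h₂, ← mul_assoc, h₁, mul_assoc]⟩

theorem MemWeyl.commute {t D t' D' S T : 𝒜} (h₁ : Commute t t') (h₂ : Commute t D')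
    (h₃ : Commute D t') (h₄ : Commute D D') (hS : MemWeyl t D S) (hT : MemWeyl t' D' T) :
    Commute S T := by
  have key : ∀ {y}, Commute y t' → Commute y D' → Commute y T := by
    intro y h h'
    induction hT with
    | pos => exact h
    | der => exact h'
    | scalar c => exact (Algebra.commutes c y).symm
    | add _ _ ih₁ ih₂ => exact ih₁.add_right ih₂
    | mul _ _ ih₁ ih₂ => exact ih₁.mul_right ih₂
  induction hS with
  | pos => exact key h₁ h₂
  | der => exact key h₃ h₄
  | scalar c => exact Algebra.commutes c T
  | add _ _ ih₁ ih₂ => exact ih₁.add_left ih₂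
  | mul _ _ ih₁ ih₂ => exact ih₁.mul_left ih₂

end Weyl

section Model

open Polynomial

/-- Multiplication by `x` on `ℂ[x][X]`, where `X ^ k` stands for `f⁽ᵏ⁾(x + z)`. -/
noncomputable def mulPos : Module.End ℂ ℂ[X][X] := LinearMap.mulLeft ℂ (C X)

/-- The operator on `ℂ[x][X]` modelling `∂/∂x`. -/
noncomputable def derivPos : Module.End ℂ ℂ[X][X] := coeffDeriv + LinearMap.mulLeft ℂ X

/-- The operator on `ℂ[x][X]` modelling `∂/∂z`. -/
noncomputable def derivSpec : Module.End ℂ ℂ[X][X] := LinearMap.mulLeft ℂ X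

/-- The symbol `X ^ r - ∑ aₖ X ^ k` of the constant coefficient part of the Airy operator. -/
noncomputable def airySymbol (r : ℕ) (a : ℕ → ℂ) : ℂ[X] :=
  X ^ r - ∑ k ∈ Finset.Ico 1 (r - 1), C (a k) * X ^ k

/-- The operator on `ℂ[x][X]` modelling multiplication by `z`. -/
noncomputable def mulSpec (r : ℕ) (a : ℕ → ℂ) : Module.End ℂ ℂ[X][X] :=
  LinearMap.mulLeft ℂ ((airySymbol r a).map C - C X) -
    (derivative : ℂ[X][X] →ₗ[ℂ[X]] ℂ[X][X]).restrictScalars ℂ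

theorem mulPos_apply (m : ℂ[X][X]) : mulPos m = C X * m := rfl

theorem derivPos_apply (m : ℂ[X][X]) : derivPos m = coeffDeriv m + X * m := rfl

theorem derivSpec_apply (m : ℂ[X][X]) : derivSpec m = X * m := rfl

theorem mulSpec_apply (r : ℕ) (a : ℕ → ℂ) (m : ℂ[X][X]) :
    mulSpec r a m = ((airySymbol r a).map C - C X) * m - derivative m := rfl

theorem coeffDeriv_map_C_mul (p : ℂ[X]) (m : ℂ[X][X]) :
    coeffDeriv (p.map C * m) = p.map C * coeffDeriv m := by
  ext1 k
  simp only [coeff_coeffDeriv, coeff_mul, derivative_sum, derivative_mul, coeff_map, derivative_C,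
    zero_mul, zero_add]

theorem coeffDeriv_C_mul (p : ℂ[X]) (m : ℂ[X][X]) :
    coeffDeriv (C p * m) = C p * coeffDeriv m + C (derivative p) * m := by
  ext1 k
  simp [coeff_coeffDeriv, derivative_mul, add_comm]

theorem coeffDeriv_X_mul (m : ℂ[X][X]) : coeffDeriv (X * m) = X * coeffDeriv m := by
  simpa using coeffDeriv_map_C_mul X m

theorem coeffDeriv_derivative (m : ℂ[X][X]) :
    coeffDeriv (derivative m) = derivative (coeffDeriv m) := by
  ext1 k
  simp [coeff_coeffDeriv, coeff_derivative, derivative_mul]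

theorem derivPos_mulPos : derivPos * mulPos - mulPos * derivPos = 1 := by
  ext1 m
  simp only [LinearMap.sub_apply, Module.End.mul_apply, mulPos_apply, derivPos_apply,
    coeffDeriv_C_mul, derivative_X, map_one, Module.End.one_apply]
  ring

theorem derivSpec_mulSpec (r : ℕ) (a : ℕ → ℂ) :
    derivSpec * mulSpec r a - mulSpec r a * derivSpec = 1 := by
  ext1 m
  simp only [LinearMap.sub_apply, Module.End.mul_apply, mulSpec_apply, derivSpec_apply,
    derivative_mul, derivative_X, Module.End.one_apply]
  ring

theorem commute_pos_spec (r : ℕ) (a : ℕ → ℂ) {S T : Module.End ℂ ℂ[X][X]}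
    (hS : MemWeyl mulPos derivPos S) (hT : MemWeyl (mulSpec r a) derivSpec T) : Commute S T := by
  refine MemWeyl.commute ?_ ?_ ?_ ?_ hS hT <;>
    refine LinearMap.ext fun m => ?_ <;>
    simp only [Module.End.mul_apply, mulPos_apply, derivPos_apply, mulSpec_apply, derivSpec_apply,
      derivative_mul, map_sub, sub_mul, map_add, coeffDeriv_C_mul, coeffDeriv_X_mul,
      coeffDeriv_map_C_mul, coeffDeriv_derivative, derivative_X, derivative_C, map_one] <;>
    ring

theorem apply_pos_spec {r : ℕ} {a : ℕ → ℂ} {S T : Module.End ℂ ℂ[X][X]}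
    (hS : MemWeyl mulPos derivPos S) (hT : MemWeyl (mulSpec r a) derivSpec T) (m : ℂ[X][X]) :
    S (T m) = T (S m) :=
  LinearMap.congr_fun (commute_pos_spec r a hS hT).eq m

theorem aeval_mulPos_apply (s : ℂ[X]) (m : ℂ[X][X]) : aeval mulPos s m = C s * m := by
  have e : aeval (C X : ℂ[X][X]) s = C s := by
    induction s using Polynomial.induction_on' with
    | add p q hp hq => simp_all
    | monomial k a =>
      rw [aeval_monomial, ← C_pow, ← C_mul_X_pow_eq_monomial, C_mul]
      rfl
  have h := Polynomial.aeval_algHom_apply (Algebra.lmul ℂ ℂ[X][X]) (C X) s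
  rw [e] at h
  exact LinearMap.congr_fun h m

theorem aeval_derivSpec_apply (s : ℂ[X]) (m : ℂ[X][X]) : aeval derivSpec s m = s.map C * m := by
  have e : aeval (X : ℂ[X][X]) s = s.map C := by
    induction s using Polynomial.induction_on' with
    | add p q hp hq => simp_all
    | monomial k a =>
      rw [aeval_monomial, map_monomial, ← C_mul_X_pow_eq_monomial]
      rfl
  have h := Polynomial.aeval_algHom_apply (Algebra.lmul ℂ ℂ[X][X]) X s
  rw [e] at h
  exact LinearMap.congr_fun h m

theorem symbol_sub_mulSpec_one (r : ℕ) (a : ℕ → ℂ) :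
    (aeval derivSpec (airySymbol r a) - mulSpec r a) 1 = C X := by
  rw [LinearMap.sub_apply, aeval_derivSpec_apply, mulSpec_apply]
  simp

theorem exists_spec_apply_one (r : ℕ) (a : ℕ → ℂ) (m : ℂ[X][X]) :
    ∃ Y, MemWeyl (mulSpec r a) derivSpec Y ∧ Y 1 = m := by
  have hx : ∀ l : ℕ, ∃ Y, MemWeyl (mulSpec r a) derivSpec Y ∧ Y 1 = (C X ^ l : ℂ[X][X]) := by
    intro l
    induction l with
    | zero => exact ⟨1, .one _ _, by simp⟩
    | succ l ih =>
      obtain ⟨Y, hY, h⟩ := ih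
      refine ⟨Y * (aeval derivSpec (airySymbol r a) - mulSpec r a),
        hY.mul ((MemWeyl.der.aeval _).sub .pos), ?_⟩
      have h1 := apply_pos_spec (S := mulPos) .pos hY 1
      rw [h, mulPos_apply, mulPos_apply, mul_one] at h1
      rw [Module.End.mul_apply, symbol_sub_mulSpec_one, ← h1, pow_succ']
  induction m using Polynomial.induction_on' with
  | add p q hp hq =>
    obtain ⟨Y, hY, rfl⟩ := hp
    obtain ⟨Z, hZ, rfl⟩ := hq
    exact ⟨Y + Z, hY.add hZ, rfl⟩
  | monomial k c =>
    induction c using Polynomial.induction_on' with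
    | add p q hp hq =>
      obtain ⟨Y, hY, h₁⟩ := hp
      obtain ⟨Z, hZ, h₂⟩ := hq
      exact ⟨Y + Z, hY.add hZ, by simp [h₁, h₂]⟩
    | monomial l c =>
      obtain ⟨Y, hY, h⟩ := hx l
      refine ⟨c • (derivSpec ^ k * Y), ((MemWeyl.der.pow k).mul hY).smul c, ?_⟩
      rw [LinearMap.smul_apply, Module.End.mul_apply, h]
      have : ∀ m, (derivSpec ^ k) m = X ^ k * m := by
        intro m
        rw [derivSpec, LinearMap.pow_mulLeft]
        rfl
      rw [this, ← C_mul_X_pow_eq_monomial, ← C_mul_X_pow_eq_monomial, ← C_pow, C_mul]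
      simp [Algebra.smul_def]
      ring

/-- `HasLead m d c`: the polynomial `m` has degree at most `d` and `d`-th coefficient `c`. -/
def HasLead (m : ℂ[X][X]) (d : ℕ) (c : ℂ[X]) : Prop := m.natDegree ≤ d ∧ m.coeff d = c

theorem hasLead_self (m : ℂ[X][X]) : HasLead m m.natDegree m.leadingCoeff := ⟨le_rfl, rfl⟩

theorem HasLead.C_mul {m : ℂ[X][X]} {d : ℕ} {c : ℂ[X]} (h : HasLead m d c) (b : ℂ[X]) :
    HasLead (C b * m) d (b * c) :=
  ⟨(natDegree_C_mul_le _ _).trans h.1, by rw [coeff_C_mul, h.2]⟩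

theorem HasLead.derivPos {m : ℂ[X][X]} {d : ℕ} {c : ℂ[X]} (h : HasLead m d c) :
    HasLead (derivPos m) (d + 1) c := by
  have hD : ∀ k, d < k → (coeffDeriv m).coeff k = 0 := fun k hk => by
    rw [coeff_coeffDeriv, coeff_eq_zero_of_natDegree_lt (by have := h.1; omega), derivative_zero]
  constructor
  · rw [derivPos_apply, natDegree_le_iff_coeff_eq_zero]
    intro k hk
    obtain ⟨k, rfl⟩ : ∃ j, k = j + 1 := ⟨k - 1, by omega⟩
    rw [coeff_add, hD _ (by omega), coeff_X_mul,
      coeff_eq_zero_of_natDegree_lt (by have := h.1; omega), add_zero]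
  · rw [derivPos_apply, coeff_add, hD _ (by omega), coeff_X_mul, h.2, zero_add]

theorem HasLead.derivPos_pow {m : ℂ[X][X]} {d : ℕ} {c : ℂ[X]} (h : HasLead m d c) (k : ℕ) :
    HasLead ((_root_.derivPos ^ k) m) (d + k) c := by
  induction k with
  | zero => simpa using h
  | succ k ih => rw [pow_succ', Module.End.mul_apply]; exact ih.derivPos

theorem HasLead.of_lt {m : ℂ[X][X]} {d d' : ℕ} {c : ℂ[X]} (h : HasLead m d c) (hd : d < d') :
    HasLead m d' 0 :=
  ⟨h.1.trans hd.le, coeff_eq_zero_of_natDegree_lt (h.1.trans_lt hd)⟩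

theorem HasLead.sum {ι : Type*} {s : Finset ι} {F : ι → ℂ[X][X]} {c : ι → ℂ[X]} {d : ℕ}
    (h : ∀ i ∈ s, HasLead (F i) d (c i)) : HasLead (∑ i ∈ s, F i) d (∑ i ∈ s, c i) := by
  refine ⟨natDegree_sum_le_of_forall_le _ _ fun i hi => (h i hi).1, ?_⟩
  rw [finsetSum_coeff]
  exact Finset.sum_congr rfl fun i hi => (h i hi).2

theorem HasLead.sum_range {F : ℕ → ℂ[X][X]} {b d : ℕ} {c : ℂ[X]}
    (hF : ∀ k < b, HasLead (F k) d 0) (hb : HasLead (F b) d c) :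
    HasLead (∑ k ∈ Finset.range (b + 1), F k) d c := by
  have := HasLead.sum (s := Finset.range (b + 1)) (F := F) (c := fun k => if k = b then c else 0)
    (d := d) fun k hk => by
      rcases (Nat.lt_succ_iff.1 (Finset.mem_range.1 hk)).lt_or_eq with h | rfl
      · simpa [h.ne] using hF k h
      · simpa using hb
  simpa using this

theorem HasLead.normalForm {B m : ℂ[X][X]} {b d : ℕ} {β c : ℂ[X]} (hB : HasLead B b β)
    (hm : HasLead m d c) : HasLead (normalForm mulPos _root_.derivPos B m) (d + b) (β * c) := by
  rw [normalForm_eq_sum _ _ _ hB.1, LinearMap.sum_apply]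
  simp only [Module.End.mul_apply, aeval_mulPos_apply]
  refine HasLead.sum_range (fun k hk => ?_) ?_
  · exact ((hm.derivPos_pow k).C_mul _).of_lt (by omega)
  · have := (hm.derivPos_pow b).C_mul (B.coeff b)
    rwa [hB.2] at this ⊢

theorem natDegree_airySymbol_le (r : ℕ) (a : ℕ → ℂ) : (airySymbol r a).natDegree ≤ r := by
  refine (natDegree_sub_le _ _).trans (max_le (by simp) ?_)
  refine natDegree_sum_le_of_forall_le _ _ fun k hk => (natDegree_C_mul_X_pow_le _ _).trans ?_
  have := Finset.mem_Ico.1 hk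
  omega

theorem coeff_airySymbol (r : ℕ) (a : ℕ → ℂ) : (airySymbol r a).coeff r = 1 := by
  rw [airySymbol, coeff_sub, coeff_X_pow_self, finsetSum_coeff, Finset.sum_eq_zero, sub_zero]
  intro k hk
  have := Finset.mem_Ico.1 hk
  rw [coeff_C_mul_X_pow, if_neg (by omega)]

theorem HasLead.mulSpec {r : ℕ} (hr : 1 ≤ r) (a : ℕ → ℂ) {m : ℂ[X][X]} {d : ℕ} {c : ℂ[X]}
    (h : HasLead m d c) : HasLead (mulSpec r a m) (d + r) c := by
  have hx : HasLead (C X * m) (d + r) 0 := (h.C_mul X).of_lt (by omega)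
  have hd : (derivative m).natDegree < d + r :=
    ((natDegree_derivative_le m).trans (Nat.sub_le _ _)).trans_lt (by have := h.1; omega)
  have hl : ((airySymbol r a).map C : ℂ[X][X]).natDegree ≤ r :=
    natDegree_map_le.trans (natDegree_airySymbol_le r a)
  rw [mulSpec_apply, sub_mul]
  constructor
  · refine (natDegree_sub_le _ _).trans (max_le
      ((natDegree_sub_le _ _).trans (max_le ?_ hx.1)) hd.le)
    rw [add_comm d]
    exact natDegree_mul_le_of_le hl h.1
  · rw [coeff_sub, coeff_sub, hx.2, coeff_eq_zero_of_natDegree_lt hd, add_comm d,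
      coeff_mul_add_eq_of_natDegree_le hl h.1, coeff_map, coeff_airySymbol, h.2]
    simp

theorem HasLead.mulSpec_pow {r : ℕ} (hr : 1 ≤ r) (a : ℕ → ℂ) {m : ℂ[X][X]} {d : ℕ} {c : ℂ[X]}
    (h : HasLead m d c) (k : ℕ) : HasLead ((_root_.mulSpec r a ^ k) m) (d + r * k) c := by
  induction k with
  | zero => simpa using h
  | succ k ih =>
    rw [pow_succ', Module.End.mul_apply, mul_add_one, ← add_assoc]
    exact ih.mulSpec hr a

theorem HasLead.aeval_mulSpec {r : ℕ} (hr : 1 ≤ r) (a : ℕ → ℂ) {m : ℂ[X][X]} {d : ℕ} {c : ℂ[X]}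
    (h : HasLead m d c) (p : ℂ[X]) :
    HasLead (aeval (_root_.mulSpec r a) p m) (d + r * p.natDegree) (C p.leadingCoeff * c) := by
  rw [aeval_eq_sum_range, LinearMap.sum_apply]
  have e : ∀ k, (p.coeff k • _root_.mulSpec r a ^ k) m =
      C (C (p.coeff k)) * (_root_.mulSpec r a ^ k) m := fun k => by
    rw [LinearMap.smul_apply, Algebra.smul_def]
    rfl
  simp only [e]
  refine HasLead.sum_range (fun k hk => ?_) ?_
  · exact ((h.mulSpec_pow hr a k).C_mul _).of_lt
      (Nat.add_lt_add_left (Nat.mul_lt_mul_of_pos_left hk hr) _)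
  · exact (h.mulSpec_pow hr a _).C_mul _

theorem HasLead.ne_zero {m : ℂ[X][X]} {d : ℕ} {c : ℂ[X]} (h : HasLead m d c) (hc : c ≠ 0) :
    m ≠ 0 := by
  rintro rfl
  exact hc (by rw [← h.2, coeff_zero])

theorem HasLead.unique {m : ℂ[X][X]} {d d' : ℕ} {c c' : ℂ[X]} (h : HasLead m d c)
    (h' : HasLead m d' c') (hc : c ≠ 0) (hc' : c' ≠ 0) : d = d' ∧ c = c' := by
  have key : d = d' := by
    rcases lt_trichotomy d d' with hd | hd | hd
    · exact absurd (h'.2.symm.trans (h.of_lt hd).2) hc'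
    · exact hd
    · exact absurd (h.2.symm.trans (h'.of_lt hd).2) hc
  subst key
  exact ⟨rfl, h.2.symm.trans h'.2⟩

theorem normalForm_pos_injective {B m : ℂ[X][X]} (hB : B ≠ 0)
    (h : normalForm mulPos derivPos B m = 0) : m = 0 := by
  by_contra hm
  exact ((hasLead_self B).normalForm (hasLead_self m)).ne_zero
    (mul_ne_zero (leadingCoeff_ne_zero.2 hB) (leadingCoeff_ne_zero.2 hm)) h

/-- Right pseudo-division of differential operators with polynomial coefficients. -/
theorem exists_pseudo_division {P : ℂ[X][X]} {N : ℕ} {W : ℂ[X]} (hP : HasLead P N W)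
    (m : ℂ[X][X]) : ∃ (e : ℕ) (Q R : ℂ[X][X]), R.degree < N ∧
      C (W ^ e) * m = normalForm mulPos derivPos Q P + R := by
  induction hd : m.natDegree using Nat.strong_induction_on generalizing m with
  | _ d ih =>
  by_cases hm : m.degree < N
  · exact ⟨0, 0, m, hm, by simp [normalForm]⟩
  have hNd : N ≤ d := by
    rw [not_lt] at hm
    rw [← hd]
    exact le_natDegree_of_coe_le_degree hm
  obtain ⟨k, rfl⟩ := Nat.exists_eq_add_of_le hNd
  have hlead : HasLead (C W * m - C m.leadingCoeff * (derivPos ^ k) P) (N + k) 0 := by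
    have h1 : HasLead (C W * m) (N + k) (W * m.leadingCoeff) := by
      have := (hasLead_self m).C_mul W
      rwa [hd] at this
    have h2 := (hP.derivPos_pow k).C_mul m.leadingCoeff
    exact ⟨(natDegree_sub_le _ _).trans (max_le h1.1 h2.1), by rw [coeff_sub, h1.2, h2.2]; ring⟩
  have hstep : ∃ (e : ℕ) (Q R : ℂ[X][X]), R.degree < N ∧
      C (W ^ e) * (C W * m - C m.leadingCoeff * (derivPos ^ k) P) =
        normalForm mulPos derivPos Q P + R := by
    by_cases h0 : C W * m - C m.leadingCoeff * (derivPos ^ k) P = 0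
    · exact ⟨0, 0, 0, by simp, by simp [h0, normalForm]⟩
    · refine ih _ ?_ _ rfl
      refine lt_of_le_of_ne hlead.1 fun h => h0 (leadingCoeff_eq_zero.1 ?_)
      rw [leadingCoeff, h, hlead.2]
  obtain ⟨e, Q, R, hR, h⟩ := hstep
  refine ⟨e + 1, Q + C (W ^ e) * monomial k m.leadingCoeff, R, hR, ?_⟩
  rw [normalForm_add, LinearMap.add_apply, normalForm_C_mul, normalForm_monomial]
  simp only [Module.End.mul_apply, aeval_mulPos_apply]
  rw [add_right_comm, ← h, pow_succ, C_mul]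
  ring

theorem one_le_natDegree_of_intertwine {r : ℕ} (hr : 1 ≤ r) (a : ℕ → ℂ) {P Q : ℂ[X][X]} {N e : ℕ}
    {W p : ℂ[X]} (hP : HasLead P N W) (hW : W ≠ 0) (hp : 0 < p.degree)
    (h : C (W ^ e) * aeval (mulSpec r a) p P = normalForm mulPos derivPos Q P) :
    1 ≤ Q.natDegree := by
  have hp0 : p ≠ 0 := by rintro rfl; simp at hp
  have h1 := (hP.aeval_mulSpec hr a p).C_mul (W ^ e)
  have hc : W ^ e * (C p.leadingCoeff * W) ≠ 0 :=
    mul_ne_zero (pow_ne_zero _ hW) (mul_ne_zero (C_ne_zero.2 (leadingCoeff_ne_zero.2 hp0)) hW)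
  rw [h] at h1
  have hQ0 : Q ≠ 0 := by
    rintro rfl
    exact h1.ne_zero hc (by simp [normalForm])
  have h2 := (hasLead_self Q).normalForm hP
  have h3 := (h1.unique h2 hc (mul_ne_zero (leadingCoeff_ne_zero.2 hQ0) hW)).1
  have h4 : 1 ≤ p.natDegree := natDegree_pos_iff_degree_pos.2 hp
  have h5 := Nat.mul_le_mul hr h4
  omega

/-- If `P` divides `q(z)²` on the right after localizing at its leading coefficient, then `P` is an
eigenvector of a differential operator in the spectral variable. -/
theorem exists_spec_eigenoperator {r : ℕ} (hr : 1 ≤ r) (a : ℕ → ℂ) {P B : ℂ[X][X]} {N e : ℕ}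
    {W q : ℂ[X]} (hP : HasLead P N W) (hW : W ≠ 0) (hq : q ≠ 0)
    (h : C (W ^ e) * aeval (mulSpec r a) (q ^ 2) 1 = normalForm mulPos derivPos B P) :
    ∃ (g : ℂ[X]) (d : ℂ[X][X]) (E : ℕ), 0 < g.degree ∧ 1 ≤ d.natDegree ∧
      normalForm (mulSpec r a) derivSpec d P = aeval (mulSpec r a) (q ^ E) (C g * P) := by
  have hone : HasLead (1 : ℂ[X][X]) 0 1 := ⟨by simp, by simp⟩
  have hB : B ≠ 0 := by
    rintro rfl
    refine ((hone.aeval_mulSpec hr a (q ^ 2)).C_mul (W ^ e)).ne_zero ?_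
      (by rw [h]; simp [normalForm])
    exact mul_ne_zero (pow_ne_zero _ hW) (mul_ne_zero
      (C_ne_zero.2 (leadingCoeff_ne_zero.2 (pow_ne_zero _ hq))) one_ne_zero)
  have hBmem := memWeyl_normalForm mulPos derivPos B
  have hqmem := fun k => (MemWeyl.pos (t := mulSpec r a) (D := derivSpec)).aeval (q ^ k)
  have hxmem := (MemWeyl.pos (t := mulPos) (D := derivPos)).aeval
  obtain ⟨E', V, -, hV⟩ := exists_mul_pow_eq_pow_mul derivPos_mulPos W hBmem e
  set g : ℂ[X] := W ^ E' * X with hg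
  have hBg : normalForm mulPos derivPos B (C g) = C (W ^ e) * V (C X) := by
    have := LinearMap.congr_fun hV (C X)
    rw [Module.End.mul_apply, Module.End.mul_apply, aeval_mulPos_apply, aeval_mulPos_apply,
      ← C_mul] at this
    exact this
  obtain ⟨Y, hY, hY1⟩ := exists_spec_apply_one r a (V (C X))
  obtain ⟨E, Z, hZ, hYZ⟩ := exists_pow_mul_eq_mul_pow (derivSpec_mulSpec r a) q hY 2
  have hYZ1 : aeval (mulSpec r a) (q ^ E) (V (C X)) = Z (aeval (mulSpec r a) (q ^ 2) 1) := by
    rw [← hY1]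
    exact LinearMap.congr_fun hYZ 1
  have hZP : Z P = aeval (mulSpec r a) (q ^ E) (C g) := by
    rw [← sub_eq_zero]
    refine normalForm_pos_injective hB ?_
    rw [map_sub, apply_pos_spec hBmem hZ, ← h, apply_pos_spec hBmem (hqmem E), hBg,
      ← aeval_mulPos_apply, ← aeval_mulPos_apply, ← apply_pos_spec (hxmem _) hZ,
      ← apply_pos_spec (hxmem _) (hqmem E), hYZ1, sub_self]
  obtain ⟨Y₁, hY₁, hY₁P⟩ := exists_spec_apply_one r a P
  obtain ⟨E₂, Z₂, hZ₂, hYZ₂⟩ := exists_pow_mul_eq_mul_pow (derivSpec_mulSpec r a) q hY₁ E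
  obtain ⟨d, hd⟩ := exists_normalForm (derivSpec_mulSpec r a) (hZ₂.mul hZ)
  have hg0 : g ≠ 0 := mul_ne_zero (pow_ne_zero _ hW) X_ne_zero
  have hgdeg : 0 < g.degree := by
    rw [hg, degree_mul, degree_X, degree_eq_natDegree (pow_ne_zero _ hW)]
    exact_mod_cast Nat.succ_pos _
  have hmain : normalForm (mulSpec r a) derivSpec d P = aeval (mulSpec r a) (q ^ E₂) (C g * P) := by
    have h1 := LinearMap.congr_fun hYZ₂ (C g)
    rw [Module.End.mul_apply, Module.End.mul_apply] at h1
    rw [hd, Module.End.mul_apply, hZP, ← h1, ← hY₁P, ← aeval_mulPos_apply,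
      apply_pos_spec (hxmem _) hY₁, aeval_mulPos_apply, mul_one]
  refine ⟨g, d, E₂, hgdeg, ?_, hmain⟩
  by_contra hd0
  have hd0 : d.natDegree = 0 := by omega
  have h1 := (hP.C_mul g).aeval_mulSpec hr a (q ^ E₂)
  have hlq : (q ^ E₂).leadingCoeff ≠ 0 := leadingCoeff_ne_zero.2 (pow_ne_zero _ hq)
  have hc : C (q ^ E₂).leadingCoeff * (g * W) ≠ 0 :=
    mul_ne_zero (C_ne_zero.2 hlq) (mul_ne_zero hg0 hW)
  have h2 := hP.aeval_mulSpec hr a (d.coeff 0)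
  rw [normalForm_eq_sum _ _ _ hd0.le] at hmain
  simp only [zero_add, Finset.range_one, Finset.sum_singleton, pow_zero, mul_one] at hmain
  rw [hmain] at h2
  have hdc : d.coeff 0 ≠ 0 := by
    intro h0
    rw [h0, map_zero] at hmain
    exact h1.ne_zero hc hmain.symm
  have h3 := (h1.unique h2 hc
    (mul_ne_zero (C_ne_zero.2 (leadingCoeff_ne_zero.2 hdc)) hW)).2
  rw [← mul_assoc] at h3
  have h4 := congrArg natDegree (mul_right_cancel₀ hW h3)
  rw [natDegree_C_mul hlq, natDegree_C] at h4
  have := natDegree_pos_iff_degree_pos.2 hgdeg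
  omega

end Model

section Realization

open Polynomial

/-- The value `∑ₖ mₖ(x) gₖ` of a polynomial `m ∈ ℂ[x][X]` at a point `x` and a sequence `g`. -/
noncomputable def jet (g : ℕ → ℂ) (x : ℂ) : ℂ[X][X] →ₗ[ℂ] ℂ :=
  Polynomial.lsum fun k => g k • (leval x : ℂ[X] →ₗ[ℂ] ℂ)

theorem jet_monomial (g : ℕ → ℂ) (x : ℂ) (k : ℕ) (c : ℂ[X]) :
    jet g x (monomial k c) = c.eval x * g k := by
  simp [jet, Polynomial.lsum, sum_monomial_index, mul_comm]

theorem jet_eq_sum (g : ℕ → ℂ) (x : ℂ) (m : ℂ[X][X]) {d : ℕ} (hd : m.natDegree ≤ d) :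
    jet g x m = ∑ k ∈ Finset.range (d + 1), (m.coeff k).eval x * g k := by
  conv_lhs => rw [m.as_sum_range' (d + 1) (by omega)]
  rw [map_sum]
  exact Finset.sum_congr rfl fun k _ => jet_monomial g x k _

theorem jet_C_mul (g : ℕ → ℂ) (x : ℂ) (c : ℂ[X]) (m : ℂ[X][X]) :
    jet g x (C c * m) = c.eval x * jet g x m := by
  induction m using Polynomial.induction_on' with
  | add p q hp hq => simp only [mul_add, map_add, hp, hq]
  | monomial k b => rw [C_mul_monomial, jet_monomial, jet_monomial, eval_mul, mul_assoc]

theorem jet_C (g : ℕ → ℂ) (x : ℂ) (c : ℂ[X]) : jet g x (C c) = c.eval x * g 0 :=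
  jet_monomial g x 0 c

theorem jet_X_mul (g : ℕ → ℂ) (x : ℂ) (m : ℂ[X][X]) :
    jet g x (X * m) = jet (fun k => g (k + 1)) x m := by
  induction m using Polynomial.induction_on' with
  | add p q hp hq => simp only [mul_add, map_add, hp, hq]
  | monomial k b => rw [X_mul_monomial, jet_monomial, jet_monomial]

theorem jet_X_pow_mul (g : ℕ → ℂ) (x : ℂ) (m : ℂ[X][X]) (j : ℕ) :
    jet g x (X ^ j * m) = jet (fun k => g (k + j)) x m := by
  induction j generalizing g with
  | zero => simp
  | succ j ih =>
    rw [pow_succ', mul_assoc, jet_X_mul, ih]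
    simp only [add_assoc]

theorem jet_linear (b c : ℂ) (g h : ℕ → ℂ) (x : ℂ) (m : ℂ[X][X]) :
    jet (fun k => b * g k + c * h k) x m = b * jet g x m + c * jet h x m := by
  induction m using Polynomial.induction_on' with
  | add p q hp hq => simp only [map_add, hp, hq]; ring
  | monomial k b => simp only [jet_monomial]; ring

theorem hasDerivAt_iteratedDeriv {u : ℂ → ℂ} {t : ℂ} (hu : AnalyticAt ℂ u t) (k : ℕ) :
    HasDerivAt (iteratedDeriv k u) (iteratedDeriv (k + 1) u t) t := by
  rw [iteratedDeriv_succ]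
  refine DifferentiableAt.hasDerivAt ?_
  rw [iteratedDeriv_eq_iterate]
  exact (hu.iterated_deriv k).differentiableAt

theorem hasDerivAt_jet {u : ℂ → ℂ} {t : ℂ} (hu : AnalyticAt ℂ u t) (m : ℂ[X][X]) :
    HasDerivAt (fun s => jet (fun k => iteratedDeriv k u s) s m)
      (jet (fun k => iteratedDeriv k u t) t (derivPos m)) t := by
  induction m using Polynomial.induction_on' with
  | add p q hp hq => simpa only [map_add] using hp.fun_add hq
  | monomial k c =>
    rw [derivPos_apply, coeffDeriv_monomial, X_mul_monomial, map_add]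
    simp only [jet_monomial]
    exact (c.hasDerivAt t).mul (hasDerivAt_iteratedDeriv hu k)

theorem iteratedDeriv_jet {u : ℂ → ℂ} {U : Set ℂ} (hU : IsOpen U) (hu : AnalyticOnNhd ℂ u U)
    (m : ℂ[X][X]) (j : ℕ) {t : ℂ} (ht : t ∈ U) :
    iteratedDeriv j (fun s => jet (fun k => iteratedDeriv k u s) s m) t =
      jet (fun k => iteratedDeriv k u t) t ((derivPos ^ j) m) := by
  induction j generalizing t with
  | zero => simp
  | succ j ih =>
    rw [iteratedDeriv_succ, pow_succ', Module.End.mul_apply]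
    have : iteratedDeriv j (fun s => jet (fun k => iteratedDeriv k u s) s m) =ᶠ[nhds t]
        fun s => jet (fun k => iteratedDeriv k u s) s ((derivPos ^ j) m) :=
      Filter.eventually_of_mem (hU.mem_nhds ht) fun s hs => ih hs
    rw [this.deriv_eq]
    exact (hasDerivAt_jet (hu t ht) _).deriv

theorem sum_iteratedDeriv_jet {u : ℂ → ℂ} {U : Set ℂ} (hU : IsOpen U) (hu : AnalyticOnNhd ℂ u U)
    (d m : ℂ[X][X]) {t : ℂ} (ht : t ∈ U) :
    ∑ k ∈ Finset.range (d.natDegree + 1), (d.coeff k).eval t *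
        iteratedDeriv k (fun s => jet (fun k => iteratedDeriv k u s) s m) t =
      jet (fun k => iteratedDeriv k u t) t (normalForm mulPos derivPos d m) := by
  rw [normalForm_eq_sum _ _ _ le_rfl, LinearMap.sum_apply, map_sum]
  refine Finset.sum_congr rfl fun k _ => ?_
  rw [Module.End.mul_apply, aeval_mulPos_apply, jet_C_mul, iteratedDeriv_jet hU hu m k ht]

theorem eval_algebraMap_div (p : ℂ[X]) {q : ℂ[X]} {t : ℂ} (hq : q.eval t ≠ 0) :
    RatFunc.eval (RingHom.id ℂ) t (algebraMap ℂ[X] (RatFunc ℂ) p / algebraMap ℂ[X] (RatFunc ℂ) q) =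
      p.eval t / q.eval t := by
  have hq0 : q ≠ 0 := by rintro rfl; simp at hq
  set f : RatFunc ℂ := algebraMap ℂ[X] (RatFunc ℂ) p / algebraMap ℂ[X] (RatFunc ℂ) q with hf
  have h : f.num * q = p * f.denom := (RatFunc.num_mul_eq_mul_denom_iff hq0).2 hf
  have hd : f.denom.eval t ≠ 0 := fun h0 => hq (eval_eq_zero_of_dvd_of_eval_eq_zero
    (RatFunc.denom_div_dvd p q) h0)
  have := congrArg (eval t) h
  rw [eval_mul, eval_mul] at this
  rw [RatFunc.eval, eval₂_id, eval₂_id, div_eq_div_iff hd hq, this]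

/-- Conjugating a polynomial differential operator by a polynomial function. -/
theorem exists_conj_operator (d : ℂ[X][X]) (hd : d ≠ 0) {w : ℂ[X]} (hw : w ≠ 0) (e : ℕ) :
    ∃ b : ℕ → RatFunc ℂ, b d.natDegree ≠ 0 ∧ ∀ F : ℂ → ℂ, Differentiable ℂ F → ∀ c t : ℂ,
      w.eval t ≠ 0 →
      ∑ k ∈ Finset.range (d.natDegree + 1), (d.coeff k).eval t * iteratedDeriv k F t =
        w.eval t ^ e * (c * F t) →
      ∑ k ∈ Finset.range (d.natDegree + 1), RatFunc.eval (RingHom.id ℂ) t (b k) *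
        iteratedDeriv k (fun s => F s / w.eval s) t = c * (F t / w.eval t) := by
  set d' := normalForm mulPos derivPos d (C w) with hd'
  have hlead : HasLead d' d.natDegree (d.leadingCoeff * w) := by
    simpa using (hasLead_self d).normalForm (m := C w) (d := 0) (c := w) ⟨by simp, by simp⟩
  refine ⟨fun k => algebraMap ℂ[X] (RatFunc ℂ) (d'.coeff k) /
    algebraMap ℂ[X] (RatFunc ℂ) (w ^ (e + 1)), ?_, ?_⟩
  · refine div_ne_zero ?_ ?_
    · rw [hlead.2]
      exact RatFunc.algebraMap_ne_zero (mul_ne_zero (leadingCoeff_ne_zero.2 hd) hw)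
    · exact RatFunc.algebraMap_ne_zero (pow_ne_zero _ hw)
  intro F hF c t ht h
  set G : ℂ → ℂ := fun s => F s / w.eval s with hG
  set U : Set ℂ := {s | w.eval s ≠ 0} with hUdef
  have hU : IsOpen U := isOpen_ne_fun w.continuous continuous_const
  have hGan : AnalyticOnNhd ℂ G U := by
    refine DifferentiableOn.analyticOnNhd (fun s hs => ?_) hU
    exact ((hF s).div w.differentiableAt hs).differentiableWithinAt
  have hFG : F =ᶠ[nhds t] fun s => jet (fun k => iteratedDeriv k G s) s (C w) := by
    refine Filter.eventually_of_mem (hU.mem_nhds ht) fun s hs => ?_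
    have hs' : w.eval s ≠ 0 := hs
    change F s = jet (fun k => iteratedDeriv k G s) s (C w)
    rw [jet_C, iteratedDeriv_zero, hG]
    field_simp
  have key := sum_iteratedDeriv_jet hU hGan d (C w) ht
  simp only [← hFG.iteratedDeriv_eq] at key
  rw [h, ← hd', jet_eq_sum _ _ _ hlead.1] at key
  have hwe : (w ^ (e + 1)).eval t ≠ 0 := by rw [eval_pow]; exact pow_ne_zero _ ht
  simp only [eval_algebraMap_div _ hwe, div_mul_eq_mul_div]
  rw [← Finset.sum_div, ← key, eval_pow]
  field_simp
  ring

/-- Entire solutions of the generalized Airy equation. -/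
def IsAiry (r : ℕ) (a : ℕ → ℂ) (u : ℂ → ℂ) : Prop :=
  Differentiable ℂ u ∧ ∀ x, airyOp r a u x = 0

theorem IsAiry.iteratedDeriv_add {r : ℕ} {a : ℕ → ℂ} {u : ℂ → ℂ} (hu : IsAiry r a u) (k : ℕ)
    (y : ℂ) :
    iteratedDeriv (k + r) u y = (∑ j ∈ Finset.Ico 1 (r - 1), a j * iteratedDeriv (k + j) u y) +
      y * iteratedDeriv k u y + k * iteratedDeriv (k - 1) u y := by
  have han : ∀ y, AnalyticAt ℂ u y := fun y => hu.1.analyticAt y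
  induction k generalizing y with
  | zero =>
    have := hu.2 y
    simp only [airyOp] at this
    simp only [zero_add, iteratedDeriv_zero, Nat.cast_zero, zero_mul, add_zero]
    linear_combination this
  | succ k ih =>
    have h1 := hasDerivAt_iteratedDeriv (han y) (k + r)
    rw [funext ih] at h1
    have h2 := ((HasDerivAt.fun_sum (u := Finset.Ico 1 (r - 1)) fun j _ =>
      (hasDerivAt_iteratedDeriv (han y) (k + j)).const_mul (a j)).add
      ((hasDerivAt_id y).mul (hasDerivAt_iteratedDeriv (han y) k))).add
      (((hasDerivAt_iteratedDeriv (han y) (k - 1))).const_mul (k : ℂ))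
    have h3 := h1.unique h2
    have h4 : (k : ℂ) * iteratedDeriv (k - 1 + 1) u y = k * iteratedDeriv k u y := by
      rcases k with _ | k <;> simp
    rw [h4] at h3
    rw [show k + 1 + r = k + r + 1 by ring, h3]
    simp only [add_right_comm k 1, Nat.add_sub_cancel, id]
    push_cast
    ring

/-- The function of `(x, z)` obtained from `m ∈ ℂ[x][X]` by `X ^ k ↦ u⁽ᵏ⁾(x + z)`. -/
noncomputable def realize (u : ℂ → ℂ) (x z : ℂ) : ℂ[X][X] →ₗ[ℂ] ℂ :=
  jet (fun k => iteratedDeriv k u (x + z)) x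

theorem realize_eq_jet (u : ℂ → ℂ) (x z : ℂ) (m : ℂ[X][X]) :
    realize u x z m = jet (fun k => iteratedDeriv k (fun t => u (t + z)) x) x m := by
  simp only [realize, iteratedDeriv_comp_add_const]

theorem realize_C_mul (u : ℂ → ℂ) (x z : ℂ) (c : ℂ[X]) (m : ℂ[X][X]) :
    realize u x z (C c * m) = c.eval x * realize u x z m := jet_C_mul _ _ _ _

theorem IsAiry.realize_mulSpec {r : ℕ} {a : ℕ → ℂ} {u : ℂ → ℂ} (hu : IsAiry r a u) (x z : ℂ)
    (m : ℂ[X][X]) : realize u x z (mulSpec r a m) = z * realize u x z m := by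
  induction m using Polynomial.induction_on' with
  | add p q hp hq => simp only [map_add, mul_add, hp, hq]
  | monomial k c =>
    rw [mulSpec_apply, sub_mul, map_sub, map_sub, airySymbol, Polynomial.map_sub,
      Polynomial.map_sum, sub_mul, Finset.sum_mul, map_sub, map_sum]
    simp only [Polynomial.map_mul, Polynomial.map_pow, map_X, map_C, mul_assoc, realize_C_mul,
      eval_C, eval_X, derivative_monomial]
    simp only [realize, jet_X_pow_mul, jet_monomial, hu.iteratedDeriv_add k (x + z)]
    have h : ∑ j ∈ Finset.Ico 1 (r - 1), a j * (c.eval x * iteratedDeriv (k + j) u (x + z)) =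
        c.eval x * ∑ j ∈ Finset.Ico 1 (r - 1), a j * iteratedDeriv (k + j) u (x + z) := by
      rw [Finset.mul_sum]
      exact Finset.sum_congr rfl fun j _ => by ring
    rw [h]
    simp only [eval_mul, eval_natCast]
    ring

theorem IsAiry.realize_aeval_mulSpec {r : ℕ} {a : ℕ → ℂ} {u : ℂ → ℂ} (hu : IsAiry r a u) (x z : ℂ)
    (p : ℂ[X]) (m : ℂ[X][X]) :
    realize u x z (aeval (mulSpec r a) p m) = p.eval z * realize u x z m := by
  induction p using Polynomial.induction_on generalizing m with
  | C b =>
    rw [aeval_C, eval_C, Module.algebraMap_end_apply, map_smul, smul_eq_mul]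
  | add p q hp hq => simp only [map_add, LinearMap.add_apply, hp, hq, eval_add, add_mul]
  | monomial n b ih =>
    rw [pow_succ, ← mul_assoc, map_mul, Module.End.mul_apply, ih, aeval_X, hu.realize_mulSpec]
    simp only [eval_mul, eval_pow, eval_C, eval_X]
    ring

theorem IsAiry.iteratedDeriv_realize_spec {r : ℕ} {a : ℕ → ℂ} {u : ℂ → ℂ} (hu : IsAiry r a u)
    (x : ℂ) (m : ℂ[X][X]) (j : ℕ) (z : ℂ) :
    iteratedDeriv j (fun s => realize u x s m) z = realize u x z ((derivSpec ^ j) m) := by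
  have key : ∀ (m : ℂ[X][X]) (z : ℂ),
      HasDerivAt (fun s => realize u x s m) (realize u x z (derivSpec m)) z := by
    intro m z
    induction m using Polynomial.induction_on' with
    | add p q hp hq => simpa only [map_add] using hp.fun_add hq
    | monomial k c =>
      rw [derivSpec_apply, X_mul_monomial]
      simp only [realize, jet_monomial]
      refine HasDerivAt.const_mul _ (HasDerivAt.comp_const_add x z ?_)
      exact hasDerivAt_iteratedDeriv (hu.1.analyticAt _) k
  induction j generalizing z with
  | zero => simp
  | succ j ih =>
    rw [iteratedDeriv_succ, funext ih, pow_succ', Module.End.mul_apply]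
    exact (key _ z).deriv

theorem IsAiry.differentiable_realize_spec {r : ℕ} {a : ℕ → ℂ} {u : ℂ → ℂ} (hu : IsAiry r a u)
    (x : ℂ) (m : ℂ[X][X]) : Differentiable ℂ fun z => realize u x z m := by
  have h : ∀ k, Differentiable ℂ (iteratedDeriv k u) := fun k y =>
    (hasDerivAt_iteratedDeriv (hu.1.analyticAt _) k).differentiableAt
  simp only [realize, jet_eq_sum _ _ m le_rfl]
  fun_prop

theorem IsAiry.differentiable_realize_pos {r : ℕ} {a : ℕ → ℂ} {u : ℂ → ℂ} (hu : IsAiry r a u)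
    (z : ℂ) (m : ℂ[X][X]) : Differentiable ℂ fun x => realize u x z m := by
  have h : ∀ k, Differentiable ℂ (iteratedDeriv k u) := fun k y =>
    (hasDerivAt_iteratedDeriv (hu.1.analyticAt _) k).differentiableAt
  simp only [realize, jet_eq_sum _ _ m le_rfl]
  fun_prop

theorem IsAiry.sum_iteratedDeriv_realize_pos {r : ℕ} {a : ℕ → ℂ} {u : ℂ → ℂ} (hu : IsAiry r a u)
    (x z : ℂ) (d m : ℂ[X][X]) :
    ∑ k ∈ Finset.range (d.natDegree + 1), (d.coeff k).eval x *
        iteratedDeriv k (fun s => realize u s z m) x =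
      realize u x z (normalForm mulPos derivPos d m) := by
  have h : Differentiable ℂ fun t => u (t + z) := hu.1.comp (differentiable_id.add_const z)
  simp only [realize_eq_jet]
  exact sum_iteratedDeriv_jet isOpen_univ (fun t _ => h.analyticAt t) d m (Set.mem_univ x)

theorem IsAiry.sum_iteratedDeriv_realize_spec {r : ℕ} {a : ℕ → ℂ} {u : ℂ → ℂ} (hu : IsAiry r a u)
    (x z : ℂ) (d m : ℂ[X][X]) :
    ∑ k ∈ Finset.range (d.natDegree + 1), (d.coeff k).eval z *
        iteratedDeriv k (fun s => realize u x s m) z =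
      realize u x z (normalForm (mulSpec r a) derivSpec d m) := by
  rw [normalForm_eq_sum _ _ _ le_rfl, LinearMap.sum_apply, map_sum]
  refine Finset.sum_congr rfl fun k _ => ?_
  rw [Module.End.mul_apply, hu.realize_aeval_mulSpec, hu.iteratedDeriv_realize_spec]

end Realization

section Wronskian

open Polynomial

/-- Every derivative of an Airy solution is a polynomial combination of the first `r` ones. -/
theorem exists_reduce_iteratedDeriv {r : ℕ} (hr : 2 ≤ r) (a : ℕ → ℂ) (k : ℕ) :
    ∃ h : ℕ → ℂ[X], ∀ u, IsAiry r a u → ∀ y, iteratedDeriv k u y =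
      ∑ l ∈ Finset.range r, (h l).eval y * iteratedDeriv l u y := by
  induction k using Nat.strong_induction_on with
  | _ k ih =>
  rcases lt_or_ge k r with hk | hk
  · refine ⟨fun l => if l = k then 1 else 0, fun u _ y => ?_⟩
    rw [Finset.sum_eq_single_of_mem k (Finset.mem_range.2 hk)]
    · simp
    · intro l _ hl
      simp [hl]
  have ih' : ∀ m, ∃ h : ℕ → ℂ[X], m < k → ∀ u, IsAiry r a u → ∀ y, iteratedDeriv m u y =
      ∑ l ∈ Finset.range r, (h l).eval y * iteratedDeriv l u y := by
    intro m
    by_cases hm : m < k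
    · obtain ⟨h, hh⟩ := ih m hm
      exact ⟨h, fun _ => hh⟩
    · exact ⟨0, fun h => absurd h hm⟩
  choose H hH using ih'
  obtain ⟨k, rfl⟩ := Nat.exists_eq_add_of_le' hk
  refine ⟨fun l => ∑ j ∈ Finset.Ico 1 (r - 1), C (a j) * H (k + j) l + X * H k l +
    C (k : ℂ) * H (k - 1) l, fun u hu y => ?_⟩
  have hsum : ∑ j ∈ Finset.Ico 1 (r - 1), a j * iteratedDeriv (k + j) u y =
      ∑ j ∈ Finset.Ico 1 (r - 1), a j *
        ∑ l ∈ Finset.range r, (H (k + j) l).eval y * iteratedDeriv l u y := by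
    refine Finset.sum_congr rfl fun j hj => ?_
    have := Finset.mem_Ico.1 hj
    rw [hH (k + j) (by omega) u hu y]
  rw [hu.iteratedDeriv_add, hsum, hH k (by omega) u hu y, hH (k - 1) (by omega) u hu y]
  simp only [Finset.mul_sum, eval_add, eval_finsetSum, eval_mul, eval_C, eval_X, add_mul,
    Finset.sum_add_distrib, Finset.sum_mul, mul_assoc]
  rw [Finset.sum_comm]

theorem IsAiry.iteratedDeriv_phi {r : ℕ} {a : ℕ → ℂ} {u : ℂ → ℂ} (hu : IsAiry r a u) (γ l : ℂ)
    (k : ℕ) (x : ℂ) : iteratedDeriv k (fun x => γ * u (x + l) + deriv u (x + l)) x =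
      γ * iteratedDeriv k u (x + l) + iteratedDeriv (k + 1) u (x + l) := by
  induction k generalizing x with
  | zero => simp [iteratedDeriv_one]
  | succ k ih =>
    rw [iteratedDeriv_succ, funext ih]
    have h := fun j => (hasDerivAt_iteratedDeriv (hu.1.analyticAt (x + l)) j).comp_add_const x l
    exact (((h k).const_mul γ).add (h (k + 1))).deriv

theorem IsAiry.differentiable_phi {r : ℕ} {a : ℕ → ℂ} {u : ℂ → ℂ} (hu : IsAiry r a u) (γ l : ℂ) :
    Differentiable ℂ fun x => γ * u (x + l) + deriv u (x + l) := by
  intro x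
  have h := fun j => (hasDerivAt_iteratedDeriv (hu.1.analyticAt (x + l)) j).comp_add_const x l
  have := (((h 0).const_mul γ).fun_add (h 1)).differentiableAt
  simpa only [iteratedDeriv_zero, iteratedDeriv_one] using this

theorem IsAiry.exists_reduce_phi {r : ℕ} (hr : 2 ≤ r) (a : ℕ → ℂ) (γ l : ℂ) (k : ℕ) :
    ∃ m : ℕ → ℂ[X], ∀ u, IsAiry r a u → ∀ x,
      iteratedDeriv k (fun x => γ * u (x + l) + deriv u (x + l)) x =
        ∑ j ∈ Finset.range r, (m j).eval x * iteratedDeriv j u (x + l) := by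
  obtain ⟨h, hh⟩ := exists_reduce_iteratedDeriv hr a k
  obtain ⟨h', hh'⟩ := exists_reduce_iteratedDeriv hr a (k + 1)
  refine ⟨fun j => (C γ * h j + h' j).comp (X + C l), fun u hu x => ?_⟩
  rw [hu.iteratedDeriv_phi, hh u hu, hh' u hu, Finset.mul_sum, ← Finset.sum_add_distrib]
  refine Finset.sum_congr rfl fun j _ => ?_
  simp only [eval_comp, eval_add, eval_mul, eval_C, eval_X]
  ring

/-- The minors of the matrix of derivatives of the functions `φ_{i,j}` are polynomials. -/
theorem exists_polynomial_minor {r n : ℕ} (hr : 2 ≤ r) {a : ℕ → ℂ} {f : ℕ → ℂ → ℂ}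
    (lam gam : ℕ → ℂ) (hf : ∀ j < r, IsAiry r a (f j))
    (hwr : ∀ x : ℂ, wrDet r (fun j => f j.val) x = 1) (κ : Fin (r * n) → ℕ) :
    ∃ p : ℂ[X], ∀ x, Matrix.det (Matrix.of fun i s =>
      iteratedDeriv (κ i) (phiFam r n f lam gam s) x) = p.eval x := by
  choose M hM using fun i k => IsAiry.exists_reduce_phi hr a (gam i) (lam i) k
  let ε : Fin (r * n) ≃ Fin r × Fin n :=
    ((finCongr (mul_comm r n)).trans finProdFinEquiv.symm).trans (Equiv.prodComm _ _)
  have hε₁ : ∀ s, ((ε s).1 : ℕ) = s.val % r := fun s => rfl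
  have hε₂ : ∀ s, ((ε s).2 : ℕ) = s.val / r := fun s => rfl
  let A : Matrix (Fin (r * n)) (Fin (r * n)) ℂ[X] :=
    Matrix.of fun i s => M (ε s).2 (κ i) (ε s).1
  let B : ℂ → Fin n → Matrix (Fin r) (Fin r) ℂ := fun x i =>
    Matrix.of fun l j => iteratedDeriv l.val (f j.val) (x + lam i)
  refine ⟨A.det, fun x => ?_⟩
  have hprod : (Matrix.of fun i s => iteratedDeriv (κ i) (phiFam r n f lam gam s) x) =
      (evalRingHom x).mapMatrix A * (Matrix.blockDiagonal (B x)).submatrix ε ε := by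
    ext i s
    have hs : s.val % r < r := Nat.mod_lt _ (by omega)
    rw [Matrix.mul_apply, Matrix.of_apply]
    change iteratedDeriv (κ i) (fun x => _ + _) x = _
    rw [hM _ _ _ (hf _ hs), ← ε.symm.sum_comp, Fintype.sum_prod_type, Finset.sum_range]
    refine Finset.sum_congr rfl fun l _ => ?_
    rw [Finset.sum_eq_single (ε s).2]
    · simp [A, B, Matrix.blockDiagonal_apply, hε₁ s, hε₂ s]
    · intro i' _ hi'
      simp [Matrix.blockDiagonal_apply, hi']
    · simp
  rw [hprod, Matrix.det_mul, Matrix.det_submatrix_equiv_self, Matrix.det_blockDiagonal,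
    ← RingHom.map_det, Finset.prod_eq_one, mul_one]
  · rfl
  · exact fun i _ => hwr _

/-- The bordered Wronskian as a differential operator with polynomial coefficients. -/
theorem exists_bordered_operator {N : ℕ} {φ : Fin N → ℂ → ℂ}
    (hφ : ∀ κ : Fin N → ℕ, ∃ p : ℂ[X], ∀ x,
      Matrix.det (Matrix.of fun i s => iteratedDeriv (κ i) (φ s) x) = p.eval x) :
    ∃ (P : ℂ[X][X]) (W : ℂ[X]), HasLead P N W ∧ (∀ x, W.eval x = wrDet N φ x) ∧
      ∀ u x, wrDetB N φ u x = jet (fun k => iteratedDeriv k u x) x P := by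
  choose c hc using fun i : Fin (N + 1) => hφ fun l => (i.succAbove l).val
  refine ⟨∑ i : Fin (N + 1), monomial i.val (C ((-1) ^ (i.val + N)) * c i), c (Fin.last N),
    ⟨?_, ?_⟩, fun x => ?_, fun u x => ?_⟩
  · exact natDegree_sum_le_of_forall_le _ _ fun i _ =>
      (natDegree_monomial_le _).trans (Nat.lt_succ_iff.1 i.2)
  · rw [finsetSum_coeff, Finset.sum_eq_single (Fin.last N)]
    · simp
    · intro i _ hi
      rw [coeff_monomial, if_neg fun h : i.val = N => hi (Fin.ext h)]
    · simp
  · rw [← hc]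
    simp [wrDet]
  · rw [wrDetB, wrDet, Matrix.det_succ_column _ (Fin.last N), map_sum]
    refine Finset.sum_congr rfl fun i _ => ?_
    rw [jet_monomial, eval_mul, ← hc, eval_C]
    have : (Matrix.of fun k s : Fin (N + 1) =>
        iteratedDeriv k.val (Fin.snoc (α := fun _ => ℂ → ℂ) φ u s) x).submatrix i.succAbove
          (Fin.last N).succAbove =
        Matrix.of fun l s => iteratedDeriv (i.succAbove l).val (φ s) x := by
      ext l s
      simp
    rw [this]
    simp
    ring

theorem wrDetB_self {N : ℕ} (φ : Fin N → ℂ → ℂ) (s : Fin N) (x : ℂ) : wrDetB N φ (φ s) x = 0 := by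
  refine Matrix.det_zero_of_column_eq (i := s.castSucc) (j := Fin.last N)
    (Fin.castSucc_lt_last s).ne fun k => ?_
  simp

/-- An operator annihilating `φ₁, …, φ_N` is divisible on the right by the bordered Wronskian
operator, up to powers of the Wronskian. -/
theorem exists_right_quotient {N : ℕ} {φ : Fin N → ℂ → ℂ} (hφ : ∀ s, Differentiable ℂ (φ s))
    {P m : ℂ[X][X]} {W : ℂ[X]} (hP : HasLead P N W) (hW : ∀ x, W.eval x = wrDet N φ x)
    (hW0 : W ≠ 0) (hPφ : ∀ s x, jet (fun k => iteratedDeriv k (φ s) x) x P = 0)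
    (hm : ∀ s x, jet (fun k => iteratedDeriv k (φ s) x) x m = 0) :
    ∃ (e : ℕ) (Q : ℂ[X][X]), C (W ^ e) * m = normalForm mulPos derivPos Q P := by
  obtain ⟨e, Q, R, hR, h⟩ := exists_pseudo_division hP m
  refine ⟨e, Q, ?_⟩
  suffices R = 0 by rw [h, this, add_zero]
  by_contra hR0
  have hRN : R.natDegree < N := (natDegree_lt_iff_degree_lt hR0).2 hR
  have hRφ : ∀ s x, jet (fun k => iteratedDeriv k (φ s) x) x R = 0 := by
    intro s x
    have h1 := congrArg (jet (fun k => iteratedDeriv k (φ s) x) x) h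
    rw [jet_C_mul, hm, map_add, ← sum_iteratedDeriv_jet isOpen_univ
      (fun t _ => (hφ s).analyticAt t) Q P (Set.mem_univ x), funext (hPφ s)] at h1
    simpa using h1.symm
  refine hR0 (Polynomial.ext fun k => ?_)
  rw [coeff_zero]
  rcases le_or_gt N k with hk | hk
  · exact coeff_eq_zero_of_natDegree_lt (hRN.trans_le hk)
  refine (mul_eq_zero.1 (Polynomial.funext fun x => ?_ : W * R.coeff k = 0)).resolve_left hW0
  rw [eval_mul, eval_zero, mul_eq_zero, or_iff_not_imp_left, hW]
  intro hdet
  have hv : (fun l : Fin N => (R.coeff l).eval x) = 0 := by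
    refine Matrix.eq_zero_of_vecMul_eq_zero hdet (funext fun s => ?_)
    have h1 := hRφ s x
    rw [jet_eq_sum _ _ _ (Nat.le_sub_one_of_lt hRN), Nat.sub_add_cancel (by omega),
      Finset.sum_range] at h1
    exact h1
  exact congrFun hv ⟨k, hk⟩

/-- Action of polynomials in `z` on a combination of a shifted Airy solution and its derivative. -/
theorem IsAiry.jet_phi_aeval_mulSpec {r : ℕ} {a : ℕ → ℂ} {u : ℂ → ℂ} (hu : IsAiry r a u)
    (γ l x : ℂ) (p : ℂ[X]) (m : ℂ[X][X]) :
    jet (fun k => iteratedDeriv k (fun x => γ * u (x + l) + deriv u (x + l)) x) x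
        (aeval (mulSpec r a) p m) =
      p.eval l * jet (fun k => iteratedDeriv k (fun x => γ * u (x + l) + deriv u (x + l)) x) x m +
        (derivative p).eval l * realize u x l m := by
  have key : ∀ m, jet (fun k => iteratedDeriv k (fun x => γ * u (x + l) + deriv u (x + l)) x) x m =
      γ * realize u x l m + realize u x l (derivSpec m) := by
    intro m
    have := jet_linear γ 1 (fun k => iteratedDeriv k u (x + l))
      (fun k => iteratedDeriv (k + 1) u (x + l)) x m
    simp only [one_mul] at this
    simp only [hu.iteratedDeriv_phi, this, realize, derivSpec_apply, jet_X_mul]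
  have hc := LinearMap.congr_fun (commute_aeval_of_commutator
    (𝒜 := Module.End ℂ ℂ[X][X]) (derivSpec_mulSpec r a) p) m
  rw [Module.End.mul_apply, LinearMap.add_apply, Module.End.mul_apply] at hc
  rw [key, key, hc, map_add, hu.realize_aeval_mulSpec, hu.realize_aeval_mulSpec,
    hu.realize_aeval_mulSpec]
  ring

theorem isAiry_of_mem_span {r : ℕ} {a : ℕ → ℂ} {f : ℕ → ℂ → ℂ} (hf : ∀ j < r, IsAiry r a (f j))
    {u : ℂ → ℂ} (hu : u ∈ Submodule.span ℂ (Set.range fun j : Fin r => f j.val)) :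
    IsAiry r a u := by
  have hcd : ∀ {v : ℂ → ℂ}, Differentiable ℂ v → ∀ (k : ℕ) x, ContDiffAt ℂ k v x :=
    fun hv k x => (hv.analyticAt x).contDiffAt
  induction hu using Submodule.span_induction with
  | mem v hv =>
    obtain ⟨j, rfl⟩ := hv
    exact hf j j.2
  | zero =>
    refine ⟨differentiable_const 0, fun x => ?_⟩
    have : ∀ k, iteratedDeriv k (0 : ℂ → ℂ) x = 0 := fun k => by
      rw [show (0 : ℂ → ℂ) = fun _ => 0 from rfl, iteratedDeriv_const]
      simp
    simp [airyOp, this]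
  | add v w _ _ hv hw =>
    refine ⟨hv.1.add hw.1, fun x => ?_⟩
    have h1 := hv.2 x
    have h2 := hw.2 x
    simp only [airyOp, iteratedDeriv_add (hcd hv.1 _ x) (hcd hw.1 _ x), Pi.add_apply, mul_add,
      Finset.sum_add_distrib] at h1 h2 ⊢
    linear_combination h1 + h2
  | smul c v _ hv =>
    refine ⟨hv.1.const_smul c, fun x => ?_⟩
    have h1 := hv.2 x
    simp only [airyOp, iteratedDeriv_const_smul_field, Pi.smul_apply, smul_eq_mul,
      mul_left_comm _ c, ← Finset.mul_sum] at h1 ⊢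
    linear_combination c * h1

end Wronskian

section Bispectral

open Polynomial

variable {r n : ℕ} {a : ℕ → ℂ} {f : ℕ → ℂ → ℂ} {lam gam : ℕ → ℂ} {fb : ℂ → ℂ} {P : ℂ[X][X]}
  {W : ℂ[X]}

/-- The eigenvalue equation in `x`. -/
theorem exists_pos_eigenoperator (hr : 2 ≤ r) (hf : ∀ j < r, IsAiry r a (f j))
    (hfb : IsAiry r a fb) (hP : HasLead P (r * n) W)
    (hW : ∀ x, W.eval x = wrDet (r * n) (phiFam r n f lam gam) x) (hW0 : W ≠ 0)
    (hPu : ∀ u x, wrDetB (r * n) (phiFam r n f lam gam) u x =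
      jet (fun k => iteratedDeriv k u x) x P)
    {p : ℂ[X]} (hp : 0 < p.degree) (hp' : ∀ i < n, (derivative p).eval (lam i) = 0) :
    ∃ m : ℕ, 1 ≤ m ∧ ∃ b : ℕ → RatFunc ℂ, b m ≠ 0 ∧
      ∀ x z : ℂ, W.eval x ≠ 0 →
        ∑ k ∈ Finset.range (m + 1), RatFunc.eval (RingHom.id ℂ) x (b k) *
          iteratedDeriv k (fun t => psiFun r n f lam gam fb t z) x =
        p.eval z * psiFun r n f lam gam fb x z := by
  have hlt : ∀ s : Fin (r * n), s.val % r < r := fun s => Nat.mod_lt _ (by omega)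
  have hdiv : ∀ s : Fin (r * n), s.val / r < n := fun s => Nat.div_lt_of_lt_mul s.2
  have hPφ : ∀ s x, jet (fun k => iteratedDeriv k (phiFam r n f lam gam s) x) x P = 0 :=
    fun s x => by rw [← hPu, wrDetB_self]
  obtain ⟨e, Q, hQ⟩ := exists_right_quotient (fun s => (hf _ (hlt s)).differentiable_phi _ _) hP hW
    hW0 hPφ (m := aeval (mulSpec r a) p P) fun s x => by
      refine ((hf _ (hlt s)).jet_phi_aeval_mulSpec _ _ x p P).trans ?_
      rw [hp' _ (hdiv s), zero_mul, add_zero]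
      exact mul_eq_zero_of_right _ (hPφ s x)
  have hQ1 := one_le_natDegree_of_intertwine (by omega) a hP hW0 hp hQ
  have hQ0 : Q ≠ 0 := by rintro rfl; simp at hQ1
  obtain ⟨b, hb, H⟩ := exists_conj_operator Q hQ0 hW0 e
  refine ⟨Q.natDegree, hQ1, b, hb, fun x z hx => ?_⟩
  have hψ : ∀ t, psiFun r n f lam gam fb t z =
      (∏ i ∈ Finset.range n, (z - lam i))⁻¹ * realize fb t z P / W.eval t := by
    intro t
    rw [psiFun, hPu, ← hW, realize_eq_jet, mul_comm (W.eval t), ← div_div,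
      div_eq_inv_mul (jet _ _ _)]
  simp only [hψ]
  refine H _ ((hfb.differentiable_realize_pos z P).const_mul _) _ _ hx ?_
  simp only [iteratedDeriv_const_mul_field, mul_left_comm _ (∏ i ∈ Finset.range n, (z - lam i))⁻¹]
  rw [← Finset.mul_sum, hfb.sum_iteratedDeriv_realize_pos, ← hQ, realize_C_mul,
    hfb.realize_aeval_mulSpec, eval_pow]

/-- The eigenvalue equation in `z`. -/
theorem exists_spec_eigenoperator_psiFun (hr : 2 ≤ r) (hf : ∀ j < r, IsAiry r a (f j))
    (hfb : IsAiry r a fb) (hP : HasLead P (r * n) W)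
    (hW : ∀ x, W.eval x = wrDet (r * n) (phiFam r n f lam gam) x) (hW0 : W ≠ 0)
    (hPu : ∀ u x, wrDetB (r * n) (phiFam r n f lam gam) u x =
      jet (fun k => iteratedDeriv k u x) x P) :
    ∃ s : ℂ[X], 0 < s.degree ∧ ∃ d : ℕ, 1 ≤ d ∧ ∃ c : ℕ → RatFunc ℂ, c d ≠ 0 ∧
      ∀ x z : ℂ, (∏ i ∈ Finset.range n, (z - lam i)) ≠ 0 →
        ∑ k ∈ Finset.range (d + 1), RatFunc.eval (RingHom.id ℂ) z (c k) *
          iteratedDeriv k (fun w => psiFun r n f lam gam fb x w) z =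
        s.eval x * psiFun r n f lam gam fb x z := by
  have hlt : ∀ s : Fin (r * n), s.val % r < r := fun s => Nat.mod_lt _ (by omega)
  have hdiv : ∀ s : Fin (r * n), s.val / r < n := fun s => Nat.div_lt_of_lt_mul s.2
  have hPφ : ∀ s x, jet (fun k => iteratedDeriv k (phiFam r n f lam gam s) x) x P = 0 :=
    fun s x => by rw [← hPu, wrDetB_self]
  set q : ℂ[X] := ∏ i ∈ Finset.range n, (X - C (lam i)) with hq
  have hqz : ∀ z, q.eval z = ∏ i ∈ Finset.range n, (z - lam i) := fun z => by
    simp [hq, eval_prod]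
  have hq0 : q ≠ 0 := (monic_prod_of_monic _ _ fun i _ => monic_X_sub_C (lam i)).ne_zero
  have hqlam : ∀ i < n, q.eval (lam i) = 0 := fun i hi => by
    rw [hqz]
    exact Finset.prod_eq_zero (Finset.mem_range.2 hi) (sub_self _)
  obtain ⟨e, B, hB⟩ := exists_right_quotient (fun s => (hf _ (hlt s)).differentiable_phi _ _) hP hW
    hW0 hPφ (m := aeval (mulSpec r a) (q ^ 2) 1) fun s x => by
      refine ((hf _ (hlt s)).jet_phi_aeval_mulSpec _ _ x (q ^ 2) 1).trans ?_
      simp [derivative_pow, hqlam _ (hdiv s)]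
  obtain ⟨g, d, E, hg, hd, h⟩ := exists_spec_eigenoperator (by omega) a hP hW0 hq0 hB
  have hd0 : d ≠ 0 := by rintro rfl; simp at hd
  obtain ⟨c, hc, H⟩ := exists_conj_operator d hd0 hq0 E
  refine ⟨g, hg, d.natDegree, hd, c, hc, fun x z hz => ?_⟩
  have hψ : ∀ t, psiFun r n f lam gam fb x t = (W.eval x)⁻¹ * realize fb x t P / q.eval t := by
    intro t
    rw [psiFun, hPu, ← hW, realize_eq_jet, ← div_div, div_eq_inv_mul (jet _ _ _), hqz]
  simp only [hψ]
  refine H _ ((hfb.differentiable_realize_spec x P).const_mul _) _ _ (by rwa [hqz]) ?_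
  simp only [iteratedDeriv_const_mul_field, mul_left_comm _ (W.eval x)⁻¹]
  rw [← Finset.mul_sum, hfb.sum_iteratedDeriv_realize_spec, h, hfb.realize_aeval_mulSpec,
    realize_C_mul, eval_pow]

end Bispectral

theorem statement0 (r n : ℕ) (a : ℕ → ℂ) (f : ℕ → ℂ → ℂ) (lam gam : ℕ → ℂ)
    (hr : 2 ≤ r) (hn : 1 ≤ n)
    (hf : ∀ j < r, Differentiable ℂ (f j))
    (hker : ∀ j < r, ∀ x : ℂ, airyOp r a (f j) x = 0)
    (hwrf : ∀ x : ℂ, wrDet r (fun j => f j.val) x = 1)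
    (hlam : ∀ i < n, ∀ j < n, i ≠ j → lam i ≠ lam j)
    (fb : ℂ → ℂ)
    (hfb : fb ∈ Submodule.span ℂ (Set.range fun j : Fin r => f j.val))
    (hfb0 : fb ≠ 0) :
    (∀ p : Polynomial ℂ, 0 < p.degree →
      (∀ i < n, (Polynomial.derivative p).eval (lam i) = 0) →
      ∃ m : ℕ, 1 ≤ m ∧ ∃ b : ℕ → RatFunc ℂ, b m ≠ 0 ∧
        ∀ x z : ℂ, wrDet (r * n) (phiFam r n f lam gam) x ≠ 0 →
          (∏ i ∈ Finset.range n, (z - lam i)) ≠ 0 →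
          (∀ k ≤ m, Polynomial.eval x (b k).denom ≠ 0) →
          ∑ k ∈ Finset.range (m + 1),
              RatFunc.eval (RingHom.id ℂ) x (b k) *
                iteratedDeriv k (fun t => psiFun r n f lam gam fb t z) x
            = p.eval z * psiFun r n f lam gam fb x z) ∧
    (∃ s : Polynomial ℂ, 0 < s.degree ∧ ∃ d : ℕ, 1 ≤ d ∧
      ∃ c : ℕ → RatFunc ℂ, c d ≠ 0 ∧
        ∀ x z : ℂ, wrDet (r * n) (phiFam r n f lam gam) x ≠ 0 →
          (∏ i ∈ Finset.range n, (z - lam i)) ≠ 0 →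
          (∀ k ≤ d, Polynomial.eval z (c k).denom ≠ 0) →
          ∑ k ∈ Finset.range (d + 1),
              RatFunc.eval (RingHom.id ℂ) z (c k) *
                iteratedDeriv k (fun w => psiFun r n f lam gam fb x w) z
            = s.eval x * psiFun r n f lam gam fb x z) := by
  have hfA : ∀ j < r, IsAiry r a (f j) := fun j hj => ⟨hf j hj, hker j hj⟩
  have hfbA := isAiry_of_mem_span hfA hfb
  obtain ⟨P, W, hP, hW, hPu⟩ := exists_bordered_operator
    fun κ => exists_polynomial_minor hr lam gam hfA hwrf κ
  by_cases hW0 : W = 0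
  · have hwr : ∀ x, wrDet (r * n) (phiFam r n f lam gam) x = 0 := fun x => by
      rw [← hW, hW0, Polynomial.eval_zero]
    exact ⟨fun p _ _ => ⟨1, le_rfl, fun _ => 1, one_ne_zero, fun x _ hx => absurd (hwr x) hx⟩,
      Polynomial.X, by simp, 1, le_rfl, fun _ => 1, one_ne_zero, fun x _ hx => absurd (hwr x) hx⟩
  constructor
  · intro p hp hp'
    obtain ⟨m, hm, b, hb, H⟩ := exists_pos_eigenoperator hr hfA hfbA hP hW hW0 hPu hp hp'
    exact ⟨m, hm, b, hb, fun x z hx _ _ => H x z (by rwa [hW])⟩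
  · obtain ⟨s, hs, d, hd, c, hc, H⟩ :=
      exists_spec_eigenoperator_psiFun hr hfA hfbA hP hW hW0 hPu
    exact ⟨s, hs, d, hd, c, hc, fun x z _ hz _ => H x z hz⟩
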